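/- Let G be a finite group, g ↦ U_g a unitary representation of G on ℂ^n, and define the twirling channel φ(σ) := |G|^{-1} Σ_{g∈G} U_g σ U_g†. Then for every density matrix ρ on ℂ^n, the infimum over all density matrices σ commuting with every U_g of the quantum relative entropy D_1(ρ‖σ) equals D_1(ρ‖φ(ρ)) = H(φ(ρ)) − H(ρ), where H denotes the von Neumann entropy. -/

import Mathlib

noncomputable section
open scoped BigOperators Classical ComplexOrder
open Matrix

namespace QC

/-- A density matrix: positive semidefinite with unit trace. -/
def IsDensity {m : Type*} [Fintype m] [DecidableEq m] (ρ : Matrix m m ℂ) : Prop :=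
  ρ.PosSemidef ∧ ρ.trace = 1

/-- A (discrete) POVM: positive semidefinite elements summing to the identity. -/
def IsPOVM {m ι : Type*} [Fintype m] [DecidableEq m] [Fintype ι]
    (X : ι → Matrix m m ℂ) : Prop :=
  (∀ x, (X x).PosSemidef) ∧ ∑ x, X x = 1

/-- A projective observable: mutually orthogonal Hermitian projections. -/
def IsProjective {m ι : Type*} [Fintype m] [DecidableEq m] [Fintype ι]
    (X : ι → Matrix m m ℂ) : Prop :=
  (∀ x, (X x).IsHermitian) ∧ ∀ x x', X x * X x' = if x = x' then X x else 0

/-- Eigenvalues of a matrix (junk value `0` if not Hermitian). -/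
noncomputable def eigs {m : Type*} [Fintype m] [DecidableEq m] (A : Matrix m m ℂ) : m → ℝ :=
  if h : A.IsHermitian then h.eigenvalues else 0

/-- Largest eigenvalue of a Hermitian matrix. -/
noncomputable def lamMax {m : Type*} [Fintype m] [DecidableEq m] (A : Matrix m m ℂ) : ℝ :=
  ⨆ i, eigs A i

/-- Real power of a Hermitian matrix, taken on its support (junk value `0` if not Hermitian).
Since `(0:ℝ) ^ r = 0` for `r ≠ 0`, the power is taken on the support. -/
noncomputable def mpow {m : Type*} [Fintype m] [DecidableEq m]
    (A : Matrix m m ℂ) (r : ℝ) : Matrix m m ℂ :=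
  if h : A.IsHermitian then
    (h.eigenvectorUnitary : Matrix m m ℂ) *
      Matrix.diagonal (fun i => ((h.eigenvalues i ^ r : ℝ) : ℂ)) *
      (star (h.eigenvectorUnitary : Matrix m m ℂ))
  else 0

/-- Logarithm of a Hermitian matrix, taken on its support. -/
noncomputable def mlog {m : Type*} [Fintype m] [DecidableEq m]
    (A : Matrix m m ℂ) : Matrix m m ℂ :=
  if h : A.IsHermitian then
    (h.eigenvectorUnitary : Matrix m m ℂ) *
      Matrix.diagonal (fun i => ((Real.log (h.eigenvalues i) : ℝ) : ℂ)) *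
      (star (h.eigenvectorUnitary : Matrix m m ℂ))
  else 0

/-- Support inclusion of matrices (as linear maps). -/
def suppLE {m : Type*} [Fintype m] [DecidableEq m] (ρ σ : Matrix m m ℂ) : Prop :=
  LinearMap.range (Matrix.toLin' ρ) ≤ LinearMap.range (Matrix.toLin' σ)

/-- Quantum relative entropy `Tr[ρ (log ρ - log σ)]` (finite part). -/
noncomputable def relEnt {m : Type*} [Fintype m] [DecidableEq m]
    (ρ σ : Matrix m m ℂ) : ℝ :=
  ((ρ * (mlog ρ - mlog σ)).trace).re

/-- `Tr[(σ^{(1-α)/(2α)} ρ σ^{(1-α)/(2α)})^α]`, computed via eigenvalues. -/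
noncomputable def sandTr {m : Type*} [Fintype m] [DecidableEq m]
    (α : ℝ) (ρ σ : Matrix m m ℂ) : ℝ :=
  ∑ i, (eigs (mpow σ ((1 - α) / (2 * α)) * ρ * mpow σ ((1 - α) / (2 * α))) i) ^ α

/-- Sandwiched Rényi divergence, `+∞` when `α ≥ 1` and the support of `ρ` is not
contained in that of `σ`; `D_1` is the quantum relative entropy. -/
noncomputable def Dren {m : Type*} [Fintype m] [DecidableEq m]
    (α : ℝ) (ρ σ : Matrix m m ℂ) : EReal :=
  if 1 ≤ α ∧ ¬ suppLE ρ σ then ⊤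
  else if α = 1 then ((relEnt ρ σ : ℝ) : EReal)
  else (((α - 1)⁻¹ * Real.log (sandTr α ρ σ) : ℝ) : EReal)

/-- Outcome distribution `p(x|ρ) = Tr(ρ X_x)`. -/
noncomputable def probOf {m ι : Type*} [Fintype m] [DecidableEq m]
    (ρ : Matrix m m ℂ) (X : ι → Matrix m m ℂ) (x : ι) : ℝ :=
  ((ρ * X x).trace).re

/-- Rényi entropy of a distribution (`α = 1` gives the Shannon entropy). -/
noncomputable def renyiH {ι : Type*} [Fintype ι] (α : ℝ) (p : ι → ℝ) : ℝ :=
  if α = 1 then ∑ x, Real.negMulLog (p x)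
  else (1 - α)⁻¹ * Real.log (∑ x, (p x) ^ α)

/-- Pinching `σ_X := Σ_x X_x σ X_x`. -/
noncomputable def pinch {m ι : Type*} [Fintype m] [DecidableEq m] [Fintype ι]
    (X : ι → Matrix m m ℂ) (σ : Matrix m m ℂ) : Matrix m m ℂ :=
  ∑ x, X x * σ * X x

/-- Rényi asymmetry of a projective observable:
`Q_α(X|ρ) = inf_σ D_α(ρ ‖ σ_X)` over density matrices `σ`. -/
noncomputable def Qproj {n : ℕ} {ι : Type*} [Fintype ι]
    (α : ℝ) (X : ι → Matrix (Fin n) (Fin n) ℂ) (ρ : Matrix (Fin n) (Fin n) ℂ) : EReal :=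
  ⨅ σ : {σ : Matrix (Fin n) (Fin n) ℂ // IsDensity σ}, Dren α ρ (pinch X σ.1)

/-- von Neumann entropy `H(ρ) = -Tr[ρ log ρ]`. -/
noncomputable def vnEnt {m : Type*} [Fintype m] [DecidableEq m] (ρ : Matrix m m ℂ) : ℝ :=
  - ((ρ * mlog ρ).trace).re

/-- A Naimark extension of a POVM `X` on `ℂ^n`: an isometry `V : ℂ^n → ℂ^m` together with a
projective observable `X̃` on `ℂ^m` with `X_x = V† X̃_x V` (i.e. `X_x = P X̃_x P` under the
identification of `ℂ^n` with its image). -/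
structure Naimark (n m : ℕ) {ι : Type*} [Fintype ι]
    (X : ι → Matrix (Fin n) (Fin n) ℂ) where
  V : Matrix (Fin m) (Fin n) ℂ
  isometry : Vᴴ * V = 1
  Xt : ι → Matrix (Fin m) (Fin m) ℂ
  projective : IsProjective Xt
  sum_eq : ∑ x, Xt x = 1
  compat : ∀ x, X x = Vᴴ * Xt x * V

/-- Rényi asymmetry of an arbitrary discrete observable relative to a fixed Naimark
extension: `Q_α(X|ρ) = inf_σ D_α(ρ ‖ σ_X̃)` over density matrices `σ` on `ℂ^n`
(regarded as matrices on `ℂ^m`). -/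
noncomputable def Qnaimark {n m : ℕ} {ι : Type*} [Fintype ι]
    {X : ι → Matrix (Fin n) (Fin n) ℂ} (α : ℝ) (E : Naimark n m X)
    (ρ : Matrix (Fin n) (Fin n) ℂ) : EReal :=
  ⨅ σ : {σ : Matrix (Fin n) (Fin n) ℂ // IsDensity σ},
    Dren α (E.V * ρ * E.Vᴴ) (pinch E.Xt (E.V * σ.1 * E.Vᴴ))


/-- Quantum relative entropy `D_1(ρ‖σ)`, `+∞` when the support of `ρ` is not
contained in the support of `σ`. -/
noncomputable def D1 {m : Type*} [Fintype m] [DecidableEq m]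
    (ρ σ : Matrix m m ℂ) : EReal :=
  if suppLE ρ σ then ((relEnt ρ σ : ℝ) : EReal) else ⊤

/-- The twirling channel of a finite family of unitaries. -/
noncomputable def twirl {n : ℕ} {G : Type*} [Fintype G]
    (U : G → Matrix (Fin n) (Fin n) ℂ) (σ : Matrix (Fin n) (Fin n) ℂ) :
    Matrix (Fin n) (Fin n) ℂ :=
  (Fintype.card G : ℂ)⁻¹ • ∑ g, U g * σ * (U g)ᴴ

section Spectral

variable {m : Type*} [Fintype m] [DecidableEq m]

lemma exists_spectral_mlog {A : Matrix m m ℂ} (hA : A.IsHermitian) :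
    ∃ (V : Matrix m m ℂ) (a : m → ℝ), Vᴴ * V = 1 ∧ V * Vᴴ = 1 ∧
      A = V * diagonal (fun i => (a i : ℂ)) * Vᴴ ∧
      mlog A = V * diagonal (fun i => (Real.log (a i) : ℂ)) * Vᴴ ∧
      (A.PosSemidef → ∀ i, 0 ≤ a i) := by
  refine ⟨hA.eigenvectorUnitary, hA.eigenvalues, ?_, ?_, ?_, ?_, fun h i => h.eigenvalues_nonneg i⟩
  · exact Unitary.coe_star_mul_self hA.eigenvectorUnitary
  · exact Unitary.coe_mul_star_self hA.eigenvectorUnitary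
  · exact hA.spectral_theorem
  · rw [mlog, dif_pos hA]
    rfl

lemma trace_spectral_mul (A B : Matrix m m ℂ) (p q : m → ℝ) :
    ((A * diagonal (fun i => (p i : ℂ)) * Aᴴ) *
      (B * diagonal (fun i => (q i : ℂ)) * Bᴴ)).trace =
      ((∑ i, ∑ j, p i * q j * Complex.normSq ((Aᴴ * B) i j) : ℝ) : ℂ) := by
  have h : ((A * diagonal (fun i => (p i : ℂ)) * Aᴴ) *
      (B * diagonal (fun i => (q i : ℂ)) * Bᴴ)).trace =
      ((diagonal (fun i => (p i : ℂ)) * (Aᴴ * B)) *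
        (diagonal (fun i => (q i : ℂ)) * (Aᴴ * B)ᴴ)).trace := by
    rw [conjTranspose_mul, conjTranspose_conjTranspose]
    simp only [Matrix.mul_assoc]
    rw [Matrix.trace_mul_comm]
    simp only [Matrix.mul_assoc]
  rw [h]
  generalize Aᴴ * B = W
  rw [Matrix.trace]
  push_cast
  refine Finset.sum_congr rfl fun i _ => ?_
  rw [Matrix.diag_apply, Matrix.mul_apply]
  refine Finset.sum_congr rfl fun j _ => ?_
  rw [diagonal_mul, diagonal_mul, conjTranspose_apply, Complex.normSq_eq_conj_mul_self]
  simp only [RCLike.star_def]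
  ring

lemma suppLE_iff_exists_mul {ρ σ : Matrix m m ℂ} : suppLE ρ σ ↔ ∃ X, ρ = σ * X := by
  constructor
  · intro h
    have hx : ∀ j, ∃ x, σ *ᵥ x = ρ *ᵥ Pi.single j 1 := fun j => by
      obtain ⟨x, hx⟩ := h ⟨Pi.single j 1, rfl⟩
      exact ⟨x, by simpa [Matrix.toLin'_apply] using hx⟩
    choose x hx using hx
    refine ⟨Matrix.of fun i j => x j i, ?_⟩
    ext i j
    have := congrFun (hx j) i
    simp only [mulVec_single_one, Matrix.col_apply] at this
    rw [← this]
    rfl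
  · rintro ⟨X, rfl⟩
    rw [suppLE, Matrix.toLin'_mul]
    exact LinearMap.range_comp_le_range _ _

lemma commute_mlog {A C : Matrix m m ℂ} (h : C * A = A * C) : C * mlog A = mlog A * C := by
  by_cases hA : A.IsHermitian
  · obtain ⟨V, a, hV, hV', hAV, hlog, -⟩ := exists_spectral_mlog hA
    have hD : (Vᴴ * C * V) * diagonal (fun i => (a i : ℂ)) =
        diagonal (fun i => (a i : ℂ)) * (Vᴴ * C * V) := by
      calc _ = Vᴴ * (C * (V * diagonal (fun i => (a i : ℂ)) * Vᴴ)) * V := by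
            simp only [Matrix.mul_assoc, hV, Matrix.mul_one]
        _ = Vᴴ * (V * diagonal (fun i => (a i : ℂ)) * Vᴴ * C) * V := by rw [← hAV, h]
        _ = (Vᴴ * V) * diagonal (fun i => (a i : ℂ)) * (Vᴴ * C * V) := by
            simp only [Matrix.mul_assoc]
        _ = _ := by rw [hV, Matrix.one_mul]
    have hL : (Vᴴ * C * V) * diagonal (fun i => (Real.log (a i) : ℂ)) =
        diagonal (fun i => (Real.log (a i) : ℂ)) * (Vᴴ * C * V) := by
      ext i j
      have hij := congrFun (congrFun hD i) j
      rw [mul_diagonal, diagonal_mul, mul_comm] at hij ⊢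
      by_cases hz : (Vᴴ * C * V) i j = 0
      · simp [hz]
      · have := mul_right_cancel₀ hz hij
        rw [Complex.ofReal_inj.mp this]
    rw [hlog]
    calc _ = (V * Vᴴ) * C * (V * diagonal (fun i => (Real.log (a i) : ℂ)) * Vᴴ) := by
          rw [hV', Matrix.one_mul]
      _ = V * ((Vᴴ * C * V) * diagonal (fun i => (Real.log (a i) : ℂ))) * Vᴴ := by
          simp only [Matrix.mul_assoc]
      _ = V * diagonal (fun i => (Real.log (a i) : ℂ)) * Vᴴ * C * (V * Vᴴ) := by
          rw [hL]; simp only [Matrix.mul_assoc]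
      _ = _ := by rw [hV', Matrix.mul_one]
  · simp [mlog, dif_neg hA]

lemma suppLE_of_mulVec_eq_zero {ρ σ : Matrix m m ℂ} (hρ : ρ.IsHermitian) (hσ : σ.IsHermitian)
    (h : ∀ v, σ *ᵥ v = 0 → ρ *ᵥ v = 0) : suppLE ρ σ := by
  obtain ⟨V, a, hV, hV', hσV, -, -⟩ := exists_spectral_mlog hσ
  have hker : ∀ j, a j = 0 → ∀ i, (ρ * V) i j = 0 := by
    intro j hj i
    have h0 : σ * V = V * diagonal (fun i => (a i : ℂ)) := by
      rw [hσV, Matrix.mul_assoc, hV, Matrix.mul_one]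
    have h1 : σ *ᵥ V.col j = 0 := by
      ext k
      have := congrFun (congrFun h0 k) j
      rw [mul_diagonal, hj, Complex.ofReal_zero, mul_zero] at this
      exact this
    exact congrFun (h _ h1) i
  rw [suppLE_iff_exists_mul]
  have hD : ρ * V * (diagonal (fun i => ((a i)⁻¹ : ℂ)) * diagonal (fun i => (a i : ℂ))) =
      ρ * V := by
    ext i j
    rw [diagonal_mul_diagonal, mul_diagonal]
    by_cases hj : a j = 0
    · simp [hker j hj i]
    · rw [inv_mul_cancel₀ (by exact_mod_cast hj), mul_one]
  have hfac : ρ = (ρ * V * diagonal (fun i => ((a i)⁻¹ : ℂ)) * Vᴴ) * σ := by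
    calc ρ = ρ * V * Vᴴ := by rw [Matrix.mul_assoc, hV', Matrix.mul_one]
      _ = ρ * V * diagonal (fun i => ((a i)⁻¹ : ℂ)) * (Vᴴ * V) *
          diagonal (fun i => (a i : ℂ)) * Vᴴ := by
        rw [hV, Matrix.mul_one, Matrix.mul_assoc (ρ * V), hD]
      _ = _ := by rw [hσV]; simp only [Matrix.mul_assoc]
  refine ⟨(ρ * V * diagonal (fun i => ((a i)⁻¹ : ℂ)) * Vᴴ)ᴴ, ?_⟩
  have := congrArg conjTranspose hfac
  rwa [conjTranspose_mul, hρ.eq, hσ.eq] at this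

lemma sub_le_mul_log_sub_log {p q : ℝ} (hp : 0 ≤ p) (hq : 0 < q) :
    p - q ≤ p * (Real.log p - Real.log q) := by
  rcases hp.eq_or_lt with rfl | hp
  · simpa using hq.le
  · have h := Real.log_le_sub_one_of_pos (div_pos hq hp)
    rw [Real.log_div hq.ne' hp.ne'] at h
    have h2 := mul_le_mul_of_nonneg_left h hp.le
    have h3 : p * (q / p - 1) = q - p := by field_simp
    linarith

/-- **Klein's inequality**: the relative entropy of density matrices is nonnegative. -/
lemma relEnt_nonneg {ρ σ : Matrix m m ℂ} (hρ : IsDensity ρ) (hσ : IsDensity σ)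
    (h : suppLE ρ σ) : 0 ≤ relEnt ρ σ := by
  obtain ⟨X, hX⟩ := suppLE_iff_exists_mul.mp h
  obtain ⟨A, p, hA, hA', hρA, hρlog, hp⟩ := exists_spectral_mlog hρ.1.isHermitian
  obtain ⟨B, q, hB, hB', hσB, hσlog, hq⟩ := exists_spectral_mlog hσ.1.isHermitian
  replace hp := hp hρ.1
  replace hq := hq hσ.1
  have hone : ∀ {V : Matrix m m ℂ}, V * Vᴴ = 1 →
      V * diagonal (fun _ => ((1 : ℝ) : ℂ)) * Vᴴ = 1 := by
    intro V hV
    simpa using hV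
  have hzero : ∀ i j, q j = 0 → p i * Complex.normSq ((Aᴴ * B) i j) = 0 := by
    intro i j hj
    have hX' : ρ = Xᴴ * σ := by
      have := congrArg conjTranspose hX
      rwa [conjTranspose_mul, hρ.1.isHermitian.eq, hσ.1.isHermitian.eq] at this
    have h1 : diagonal (fun i => (p i : ℂ)) * (Aᴴ * B) =
        (Aᴴ * Xᴴ * B) * diagonal (fun i => (q i : ℂ)) := by
      calc _ = (Aᴴ * A) * diagonal (fun i => (p i : ℂ)) * (Aᴴ * B) := by
            rw [hA, Matrix.one_mul]
        _ = Aᴴ * ρ * B := by rw [hρA]; simp only [Matrix.mul_assoc]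
        _ = Aᴴ * Xᴴ * B * diagonal (fun i => (q i : ℂ)) * (Bᴴ * B) := by
            rw [hX', hσB]; simp only [Matrix.mul_assoc]
        _ = _ := by rw [hB, Matrix.mul_one]
    have h2 := congrFun (congrFun h1 i) j
    rw [diagonal_mul, mul_diagonal, hj, Complex.ofReal_zero, mul_zero] at h2
    rcases mul_eq_zero.mp h2 with h3 | h3
    · rw [Complex.ofReal_eq_zero.mp h3, zero_mul]
    · rw [h3, map_zero, mul_zero]
  have hrr : (ρ * mlog ρ).trace.re =
      ∑ i, ∑ j, p i * Real.log (p i) * Complex.normSq ((Aᴴ * B) i j) := by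
    have : ρ * mlog ρ = (A * diagonal (fun i => ((p i * Real.log (p i) : ℝ) : ℂ)) * Aᴴ) *
        (B * diagonal (fun _ => ((1 : ℝ) : ℂ)) * Bᴴ) := by
      rw [hone hB', Matrix.mul_one, hρlog]
      conv_lhs => rw [hρA]
      calc _ = A * diagonal (fun i => (p i : ℂ)) * (Aᴴ * A) *
            diagonal (fun i => (Real.log (p i) : ℂ)) * Aᴴ := by simp only [Matrix.mul_assoc]
        _ = _ := by
            rw [hA, Matrix.mul_one, Matrix.mul_assoc A, diagonal_mul_diagonal]
            push_cast
            rfl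
    rw [this, trace_spectral_mul, Complex.ofReal_re]
    simp only [mul_one]
  have hrs : (ρ * mlog σ).trace.re =
      ∑ i, ∑ j, p i * Real.log (q j) * Complex.normSq ((Aᴴ * B) i j) := by
    rw [hσlog, hρA, trace_spectral_mul, Complex.ofReal_re]
  have htr : ∑ i, ∑ j, p i * Complex.normSq ((Aᴴ * B) i j) = 1 := by
    have := trace_spectral_mul A B p (fun _ => 1)
    rw [hone hB', Matrix.mul_one, ← hρA, hρ.2] at this
    simpa using (Complex.ofReal_injective this).symm
  have hts : ∑ i, ∑ j, q j * Complex.normSq ((Aᴴ * B) i j) = 1 := by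
    have := trace_spectral_mul A B (fun _ => 1) q
    rw [hone hA', Matrix.one_mul, ← hσB, hσ.2] at this
    simpa using (Complex.ofReal_injective this).symm
  rw [relEnt, Matrix.mul_sub, Matrix.trace_sub, Complex.sub_re, hrr, hrs]
  have hsum : ∑ i, ∑ j, (p i * Complex.normSq ((Aᴴ * B) i j) -
        q j * Complex.normSq ((Aᴴ * B) i j)) ≤
      ∑ i, ∑ j, (p i * Real.log (p i) * Complex.normSq ((Aᴴ * B) i j) -
        p i * Real.log (q j) * Complex.normSq ((Aᴴ * B) i j)) := by
    refine Finset.sum_le_sum fun i _ => Finset.sum_le_sum fun j _ => ?_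
    have hc := Complex.normSq_nonneg ((Aᴴ * B) i j)
    rcases (hq j).eq_or_lt with hj | hj
    · have := hzero i j hj.symm
      rw [← hj, Real.log_zero, this, mul_right_comm, this]
      simp
    · have := mul_le_mul_of_nonneg_right (sub_le_mul_log_sub_log (hp i) hj) hc
      linarith
  simp only [Finset.sum_sub_distrib] at hsum
  linarith

end Spectral

section Twirl

variable {n : ℕ} {G : Type*} [Fintype G] {U : G → Matrix (Fin n) (Fin n) ℂ}

lemma trace_twirl_mul (hunit : ∀ g, U g ∈ Matrix.unitaryGroup (Fin n) ℂ) [Nonempty G]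
    (ρ : Matrix (Fin n) (Fin n) ℂ) {T : Matrix (Fin n) (Fin n) ℂ}
    (hT : ∀ g, U g * T = T * U g) : (twirl U ρ * T).trace = (ρ * T).trace := by
  have hg : ∀ g, (U g * ρ * (U g)ᴴ * T).trace = (ρ * T).trace := by
    intro g
    have hu : (U g)ᴴ * U g = 1 := Matrix.mem_unitaryGroup_iff'.mp (hunit g)
    rw [Matrix.mul_assoc, Matrix.mul_assoc, Matrix.trace_mul_comm, Matrix.mul_assoc,
      Matrix.mul_assoc, ← hT, ← Matrix.mul_assoc (U g)ᴴ, hu, Matrix.one_mul]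
  rw [twirl, Matrix.smul_mul, Matrix.sum_mul, Matrix.trace_smul, Matrix.trace_sum]
  simp only [hg, Finset.sum_const, Finset.card_univ, nsmul_eq_mul, smul_eq_mul]
  rw [inv_mul_cancel_left₀]
  exact_mod_cast Fintype.card_ne_zero

lemma posSemidef_twirl {ρ : Matrix (Fin n) (Fin n) ℂ} (hρ : ρ.PosSemidef) :
    (twirl U ρ).PosSemidef :=
  (Matrix.posSemidef_sum _ fun g _ => hρ.mul_mul_conjTranspose_same (U g)).smul
    (inv_nonneg.mpr (Nat.cast_nonneg _))

lemma isDensity_twirl [Nonempty G] (hunit : ∀ g, U g ∈ Matrix.unitaryGroup (Fin n) ℂ)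
    {ρ : Matrix (Fin n) (Fin n) ℂ} (hρ : IsDensity ρ) : IsDensity (twirl U ρ) := by
  refine ⟨posSemidef_twirl hρ.1, ?_⟩
  have := trace_twirl_mul hunit ρ (T := 1) (by simp)
  rwa [Matrix.mul_one, Matrix.mul_one, hρ.2] at this

lemma suppLE_twirl_of_commute {ρ σ : Matrix (Fin n) (Fin n) ℂ}
    (hσ : ∀ g, U g * σ = σ * U g) (h : suppLE ρ σ) : suppLE (twirl U ρ) σ := by
  obtain ⟨X, rfl⟩ := suppLE_iff_exists_mul.mp h
  refine suppLE_iff_exists_mul.mpr ⟨twirl U X, ?_⟩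
  rw [twirl, twirl, Matrix.mul_smul, Matrix.mul_sum]
  simp only [← Matrix.mul_assoc, hσ]

lemma commute_twirl [Group G] (hunit : ∀ g, U g ∈ Matrix.unitaryGroup (Fin n) ℂ)
    (hhom : ∀ g h, U g * U h = U (g * h)) (ρ : Matrix (Fin n) (Fin n) ℂ) (g : G) :
    U g * twirl U ρ = twirl U ρ * U g := by
  have hu : (U g)ᴴ * U g = 1 := Matrix.mem_unitaryGroup_iff'.mp (hunit g)
  have h : U g * (∑ k, U k * ρ * (U k)ᴴ) * (U g)ᴴ = ∑ k, U k * ρ * (U k)ᴴ := by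
    rw [Matrix.mul_sum, Matrix.sum_mul]
    conv_rhs => rw [← Equiv.sum_comp (Equiv.mulLeft g)]
    refine Finset.sum_congr rfl fun k _ => ?_
    rw [Equiv.coe_mulLeft, ← hhom, conjTranspose_mul]
    simp only [Matrix.mul_assoc]
  rw [twirl, Matrix.mul_smul, Matrix.smul_mul]
  congr 1
  conv_rhs => rw [← h]
  rw [Matrix.mul_assoc _ _ (U g), hu, Matrix.mul_one]

lemma suppLE_twirl_self [Group G] (hunit : ∀ g, U g ∈ Matrix.unitaryGroup (Fin n) ℂ)
    (hhom : ∀ g h, U g * U h = U (g * h)) {ρ : Matrix (Fin n) (Fin n) ℂ}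
    (hρ : ρ.PosSemidef) : suppLE ρ (twirl U ρ) := by
  have hU1 : U 1 = 1 := by
    have hu : (U 1)ᴴ * U 1 = 1 := Matrix.mem_unitaryGroup_iff'.mp (hunit 1)
    calc U 1 = (U 1)ᴴ * U 1 * U 1 := by rw [hu, Matrix.one_mul]
      _ = 1 := by rw [Matrix.mul_assoc, hhom, mul_one, hu]
  refine suppLE_of_mulVec_eq_zero hρ.isHermitian (posSemidef_twirl hρ).isHermitian fun v hv => ?_
  have hcard : (Fintype.card G : ℂ)⁻¹ ≠ 0 :=
    inv_ne_zero (by exact_mod_cast Fintype.card_ne_zero)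
  rw [twirl, Matrix.smul_mulVec, smul_eq_zero_iff_right hcard, Matrix.sum_mulVec] at hv
  have hs : ∑ g, star v ⬝ᵥ ((U g * ρ * (U g)ᴴ) *ᵥ v) = 0 := by
    rw [← dotProduct_sum, hv, dotProduct_zero]
  have h1 := (Finset.sum_eq_zero_iff_of_nonneg fun g _ =>
    (hρ.mul_mul_conjTranspose_same (U g)).dotProduct_mulVec_nonneg v).mp hs 1 (Finset.mem_univ _)
  rw [hU1, conjTranspose_one, Matrix.one_mul, Matrix.mul_one] at h1
  exact (hρ.dotProduct_mulVec_zero_iff v).mp h1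

end Twirl

/-- For a unitary representation of a finite group, the standard asymmetry
evaluates via the twirling channel:
`inf {D_1(ρ‖σ) : [σ, U_g] = 0 ∀g} = D_1(ρ‖φ(ρ)) = H(φ(ρ)) - H(ρ)`. -/
theorem standard_asymmetry_group
    {n : ℕ} {G : Type*} [Fintype G] [Group G]
    (U : G → Matrix (Fin n) (Fin n) ℂ)
    (hunit : ∀ g, U g ∈ Matrix.unitaryGroup (Fin n) ℂ)
    (hhom : ∀ g h, U g * U h = U (g * h))
    (ρ : Matrix (Fin n) (Fin n) ℂ) (hρ : IsDensity ρ) :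
    (⨅ σ : {σ : Matrix (Fin n) (Fin n) ℂ // IsDensity σ ∧ ∀ g, U g * σ = σ * U g},
        D1 ρ σ.1) = D1 ρ (twirl U ρ) ∧
    D1 ρ (twirl U ρ) = ((vnEnt (twirl U ρ) - vnEnt ρ : ℝ) : EReal) := by
  have hφ := isDensity_twirl hunit hρ
  have hcomm := commute_twirl hunit hhom ρ
  have hsupp := suppLE_twirl_self hunit hhom hρ.1
  have htr : ∀ σ, (∀ g, U g * σ = σ * U g) →
      (twirl U ρ * mlog σ).trace = (ρ * mlog σ).trace := fun σ hσ =>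
    trace_twirl_mul hunit ρ fun g => commute_mlog (hσ g)
  refine ⟨le_antisymm (iInf_le_of_le ⟨twirl U ρ, hφ, hcomm⟩ le_rfl) (le_iInf ?_), ?_⟩
  · rintro ⟨σ, hσ, hσU⟩
    by_cases h : suppLE ρ σ
    · have hK := relEnt_nonneg hφ hσ (suppLE_twirl_of_commute hσU h)
      simp only [D1, if_pos h, if_pos hsupp, EReal.coe_le_coe_iff]
      simp only [relEnt, Matrix.mul_sub, Matrix.trace_sub, Complex.sub_re, htr σ hσU,
        htr _ hcomm] at hK ⊢
      linarith
    · simp [D1, if_neg h]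
  · rw [D1, if_pos hsupp, EReal.coe_eq_coe_iff, relEnt, vnEnt, vnEnt, htr _ hcomm,
      Matrix.mul_sub, Matrix.trace_sub, Complex.sub_re]
    ring

end QC
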